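/- Given c ∈ ℭ_+ and a sequence γ = (γ_k)_{k∈Λ} with γ_0 = 1 and γ_{−k} = conj(γ_k), the functional (P,Q) ↦ J(P,Q) is lower semicontinuous on 𝔓̄_{+,∘} × (𝔓̄_+ \ {0}) (with respect to the topology of the finite-dimensional coefficient spaces). -/

import Mathlib

open MeasureTheory Complex Set

noncomputable section

namespace RCE

/-- The scalar product (k,θ) = Σⱼ kⱼ θⱼ. -/
def dotP (d : ℕ) (k : Fin d → ℤ) (θ : Fin d → ℝ) : ℝ := ∑ j, (k j : ℝ) * θ j

/-- The d-dimensional torus 𝕋^d = (−π,π]^d. -/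
def Td (d : ℕ) : Set (Fin d → ℝ) := Set.univ.pi fun _ => Set.Ioc (-Real.pi) Real.pi

/-- Normalized Lebesgue measure dm = (2π)^{-d} dθ on 𝕋^d. -/
def dm (d : ℕ) : Measure (Fin d → ℝ) :=
  (ENNReal.ofReal ((2 * Real.pi) ^ d))⁻¹ • (volume.restrict (Td d))

/-- Conjugate-symmetric coefficient sequences supported on Λ. -/
def IsCoeff (d : ℕ) (Λ : Finset (Fin d → ℤ)) (p : (Fin d → ℤ) → ℂ) : Prop :=
  (∀ k, k ∉ Λ → p k = 0) ∧ ∀ k, p (-k) = starRingEnd ℂ (p k)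

/-- Evaluation of the (real-valued) trigonometric polynomial
`P(e^{iθ}) = Σ_{k∈Λ} p_k e^{-i(k,θ)}`. -/
def eval (d : ℕ) (Λ : Finset (Fin d → ℤ)) (p : (Fin d → ℤ) → ℂ) (θ : Fin d → ℝ) : ℝ :=
  (∑ k ∈ Λ, p k * Complex.exp (-(dotP d k θ : ℂ) * Complex.I)).re

/-- `𝔓̄₊` : the closed cone of nonnegative trigonometric polynomials. -/
def Pbar (d : ℕ) (Λ : Finset (Fin d → ℤ)) : Set ((Fin d → ℤ) → ℂ) :=
  {p | IsCoeff d Λ p ∧ ∀ θ ∈ Td d, 0 ≤ eval d Λ p θ}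

/-- `𝔓₊` : the open cone of positive trigonometric polynomials. -/
def Pplus (d : ℕ) (Λ : Finset (Fin d → ℤ)) : Set ((Fin d → ℤ) → ℂ) :=
  {p | IsCoeff d Λ p ∧ ∀ θ ∈ Td d, 0 < eval d Λ p θ}

/-- The pairing ⟨c,p⟩ = Σ_{k∈Λ} c_k conj(p_k) (real-valued by conjugate symmetry). -/
def pair (d : ℕ) (Λ : Finset (Fin d → ℤ)) (c p : (Fin d → ℤ) → ℂ) : ℝ :=
  (∑ k ∈ Λ, c k * starRingEnd ℂ (p k)).re

/-- `ℭ₊` : the interior of the dual cone. -/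
def Cplus (d : ℕ) (Λ : Finset (Fin d → ℤ)) : Set ((Fin d → ℤ) → ℂ) :=
  {c | IsCoeff d Λ c ∧ ∀ p ∈ Pbar d Λ, p ≠ 0 → 0 < pair d Λ c p}

/-- `ℭ̄₊` : the closed dual cone. -/
def Cbar (d : ℕ) (Λ : Finset (Fin d → ℤ)) : Set ((Fin d → ℤ) → ℂ) :=
  {c | IsCoeff d Λ c ∧ ∀ p ∈ Pbar d Λ, 0 ≤ pair d Λ c p}

/-- The dual functional J_P(Q) = ⟨c,q⟩ − ∫ P log Q dm. -/
def J (d : ℕ) (Λ : Finset (Fin d → ℤ)) (c P Q : (Fin d → ℤ) → ℂ) : ℝ :=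
  pair d Λ c Q - ∫ θ, eval d Λ P θ * Real.log (eval d Λ Q θ) ∂(dm d)

/-- Covariance matching for an absolutely continuous measure Φ dm:
`c_k = ∫ e^{i(k,θ)} Φ(θ) dm(θ)` for all k ∈ Λ. -/
def Matches (d : ℕ) (Λ : Finset (Fin d → ℤ)) (c : (Fin d → ℤ) → ℂ)
    (Φ : (Fin d → ℝ) → ℝ) : Prop :=
  ∀ k ∈ Λ, c k = ∫ θ, Complex.exp ((dotP d k θ : ℂ) * Complex.I) * (Φ θ : ℂ) ∂(dm d)

/-- `𝔓̄₊,∘` : nonnegative trigonometric polynomials normalized by p₀ = 1. -/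
def Pbaro (d : ℕ) (Λ : Finset (Fin d → ℤ)) : Set ((Fin d → ℤ) → ℂ) :=
  {p | p ∈ Pbar d Λ ∧ p 0 = 1}

/-- `𝔓₊,∘` : positive trigonometric polynomials normalized by p₀ = 1. -/
def Ppluso (d : ℕ) (Λ : Finset (Fin d → ℤ)) : Set ((Fin d → ℤ) → ℂ) :=
  {p | p ∈ Pplus d Λ ∧ p 0 = 1}

/-- The functional J(P,Q) = ⟨c,q⟩ − ⟨γ,p⟩ + ∫ P log(P/Q) dm, with the convention
P log(P/Q) := 0 where P = 0. -/
def J2 (d : ℕ) (Λ : Finset (Fin d → ℤ)) (c γ P Q : (Fin d → ℤ) → ℂ) : ℝ :=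
  pair d Λ c Q - pair d Λ γ P +
    ∫ θ, (if eval d Λ P θ = 0 then 0
          else eval d Λ P θ * Real.log (eval d Λ P θ / eval d Λ Q θ)) ∂(dm d)

/-- The gap `M - log x` with values in `[0, ∞]`, equal to `∞` at `x = 0`. -/
def logGap (M x : ℝ) : ENNReal := if x = 0 then ⊤ else ENNReal.ofReal (M - Real.log x)

lemma measurable_logGap (M : ℝ) : Measurable (logGap M) := by
  unfold logGap
  refine Measurable.ite (measurableSet_singleton 0) measurable_const ?_
  fun_prop

lemma ae_eval_circle_ne_zero {p : Polynomial ℂ} (hp : p ≠ 0) :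
    ∀ᵐ x : ℝ, p.eval (circleMap 0 1 x) ≠ 0 := by
  have hfin : {z : ℂ | p.eval z = 0}.Countable :=
    (Polynomial.finite_setOfPred_isRoot hp).countable
  filter_upwards [compl_mem_ae_iff.2
    ((hfin.preimage_circleMap 0 one_ne_zero).measure_zero volume)] with x hx
  exact hx

/-- Jensen's inequality for the leading coefficient, in terms of `logGap`. -/
lemma lintegral_logGap_eval_le (p : Polynomial ℂ) (n : ℕ) (hn : p.natDegree ≤ n) (M : ℝ)
    (hM : ∀ x : ℝ, ‖p.eval (circleMap 0 1 x)‖ ≤ Real.exp M) :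
    ∫⁻ x in Ioc (-Real.pi) Real.pi, logGap M ‖p.eval (circleMap 0 1 x)‖ ≤
      ENNReal.ofReal (2 * Real.pi) * logGap M ‖p.coeff n‖ := by
  have h2pi : 0 < 2 * Real.pi := by positivity
  by_cases hc : p.coeff n = 0
  · simp [hc, logGap, ENNReal.mul_top, Real.pi_pos]
  have hp : p ≠ 0 := by rintro rfl; simp at hc
  have hdeg : p.natDegree = n := le_antisymm hn (Polynomial.le_natDegree_of_ne_zero hc)
  set g : ℝ → ℝ := fun x => Real.log ‖p.eval (circleMap 0 1 x)‖ with hg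
  have hper : Function.Periodic g (2 * Real.pi) := fun x => by
    simp only [hg, (periodic_circleMap 0 1) x]
  have hint : IntervalIntegrable g volume (-Real.pi) Real.pi :=
    hper.intervalIntegrable₀ h2pi.ne' p.intervalIntegrable_mahlerMeasure _ _
  have hpi : -Real.pi ≤ Real.pi := by linarith [Real.pi_pos]
  have heq : ∫ x in (-Real.pi)..Real.pi, g x = 2 * Real.pi * p.logMahlerMeasure := by
    have := hper.intervalIntegral_add_eq (-Real.pi) 0
    rw [zero_add, show -Real.pi + 2 * Real.pi = Real.pi by ring] at this
    rw [this, p.logMahlerMeasure_def, Real.circleAverage_def, smul_eq_mul, ← mul_assoc,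
      mul_inv_cancel₀ h2pi.ne', one_mul]
  have hae : ∀ᵐ x ∂volume.restrict (Ioc (-Real.pi) Real.pi), p.eval (circleMap 0 1 x) ≠ 0 :=
    ae_restrict_of_ae (ae_eval_circle_ne_zero hp)
  have hintM : IntervalIntegrable (fun x => M - g x) volume (-Real.pi) Real.pi :=
    intervalIntegrable_const.sub hint
  have hle : Real.log ‖p.coeff n‖ ≤ p.logMahlerMeasure := by
    rw [p.logMahlerMeasure_eq_log_MahlerMeasure]
    refine Real.log_le_log (norm_pos_iff.2 hc) ?_
    have := p.leadingCoeff_le_mahlerMeasure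
    rwa [Polynomial.leadingCoeff, hdeg] at this
  calc ∫⁻ x in Ioc (-Real.pi) Real.pi, logGap M ‖p.eval (circleMap 0 1 x)‖
      = ∫⁻ x in Ioc (-Real.pi) Real.pi, ENNReal.ofReal (M - g x) := by
        refine lintegral_congr_ae ?_
        filter_upwards [hae] with x hx
        rw [logGap, if_neg (norm_ne_zero_iff.2 hx)]
    _ = ENNReal.ofReal (∫ x in (-Real.pi)..Real.pi, (M - g x)) := by
        rw [intervalIntegral.integral_of_le hpi]
        refine (ofReal_integral_eq_lintegral_ofReal
          ((intervalIntegrable_iff_integrableOn_Ioc_of_le hpi).1 hintM) ?_).symm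
        filter_upwards [hae] with x hx
        have := Real.log_le_log (norm_pos_iff.2 hx) (hM x)
        rw [Real.log_exp] at this
        simpa [hg] using this
    _ ≤ ENNReal.ofReal (2 * Real.pi * (M - Real.log ‖p.coeff n‖)) := by
        refine ENNReal.ofReal_le_ofReal ?_
        rw [intervalIntegral.integral_sub intervalIntegrable_const hint, heq]
        simp only [intervalIntegral.integral_const, smul_eq_mul]
        nlinarith
    _ = ENNReal.ofReal (2 * Real.pi) * logGap M ‖p.coeff n‖ := by
        rw [logGap, if_neg (norm_ne_zero_iff.2 hc), ENNReal.ofReal_mul h2pi.le]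

/-- The complex exponential sum `Σ_{k∈Λ} q_k e^{-i(k,θ)}`. -/
def expSum (d : ℕ) (Λ : Finset (Fin d → ℤ)) (q : (Fin d → ℤ) → ℂ) (θ : Fin d → ℝ) : ℂ :=
  ∑ k ∈ Λ, q k * Complex.exp (-(dotP d k θ : ℂ) * Complex.I)

lemma norm_exp_neg_ofReal_mul_I (t : ℝ) : ‖Complex.exp (-(t : ℂ) * Complex.I)‖ = 1 := by
  rw [← Complex.ofReal_neg, Complex.norm_exp_ofReal_mul_I]

lemma norm_expSum_le (d : ℕ) (Λ : Finset (Fin d → ℤ)) (q : (Fin d → ℤ) → ℂ) (θ : Fin d → ℝ) :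
    ‖expSum d Λ q θ‖ ≤ ∑ k ∈ Λ, ‖q k‖ :=
  (norm_sum_le _ _).trans_eq (Finset.sum_congr rfl fun k _ => by
    rw [norm_mul, norm_exp_neg_ofReal_mul_I, mul_one])

lemma continuous_dotP (d : ℕ) (k : Fin d → ℤ) : Continuous (dotP d k) := by
  unfold dotP; fun_prop

lemma continuous_expSum (d : ℕ) (Λ : Finset (Fin d → ℤ)) (q : (Fin d → ℤ) → ℂ) :
    Continuous (expSum d Λ q) := by
  have := continuous_dotP d
  unfold expSum; fun_prop

lemma dotP_cons (d : ℕ) (k : Fin (d + 1) → ℤ) (x : ℝ) (y : Fin d → ℝ) :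
    dotP (d + 1) k (Fin.cons x y) = k 0 * x + dotP d (Fin.tail k) y := by
  simp [dotP, Fin.sum_univ_succ, Fin.tail]

/-- The exponential sum as a polynomial in the first variable, shifted by `K`. -/
def slicePoly (d : ℕ) (Λ : Finset (Fin (d + 1) → ℤ)) (q : (Fin (d + 1) → ℤ) → ℂ) (K : ℤ)
    (y : Fin d → ℝ) : Polynomial ℂ :=
  ∑ k ∈ Λ, Polynomial.monomial (K - k 0).toNat
    (q k * Complex.exp (-(dotP d (Fin.tail k) y : ℂ) * Complex.I))

lemma eval_slicePoly (d : ℕ) (Λ : Finset (Fin (d + 1) → ℤ)) (q : (Fin (d + 1) → ℤ) → ℂ) (K : ℤ)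
    (hK : ∀ k ∈ Λ, k 0 ≤ K) (x : ℝ) (y : Fin d → ℝ) :
    (slicePoly d Λ q K y).eval (circleMap 0 1 x) =
      Complex.exp ((K * x : ℝ) * Complex.I) * expSum (d + 1) Λ q (Fin.cons x y) := by
  rw [slicePoly, Polynomial.eval_finsetSum, expSum, Finset.mul_sum]
  refine Finset.sum_congr rfl fun k hk => ?_
  have h : (((K - k 0).toNat : ℕ) : ℂ) = (K : ℂ) - (k 0 : ℂ) := by
    have := Int.toNat_of_nonneg (sub_nonneg.2 (hK k hk))
    exact_mod_cast congrArg (Int.cast : ℤ → ℂ) this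
  rw [Polynomial.eval_monomial, circleMap, zero_add, Complex.ofReal_one, one_mul,
    ← Complex.exp_nat_mul, h, mul_assoc, ← Complex.exp_add,
    mul_left_comm (Complex.exp _), ← Complex.exp_add,
    dotP_cons]
  push_cast
  ring_nf

lemma lintegral_logGap_expSum_lt_top (d : ℕ) (Λ : Finset (Fin d → ℤ)) (hΛ : Λ.Nonempty)
    (q : (Fin d → ℤ) → ℂ) (hq : ∀ k ∈ Λ, q k ≠ 0) (M : ℝ) (hM : ∑ k ∈ Λ, ‖q k‖ ≤ Real.exp M) :
    ∫⁻ θ, logGap M ‖expSum d Λ q θ‖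
      ∂(Measure.pi fun _ : Fin d => volume.restrict (Ioc (-Real.pi) Real.pi)) < ⊤ := by
  induction d with
  | zero =>
    obtain ⟨k, hk⟩ := hΛ
    have hs : Λ = {k} := by ext j; simp [Subsingleton.elim j k, hk]
    have h : ∀ θ, logGap M ‖expSum 0 Λ q θ‖ = ENNReal.ofReal (M - Real.log ‖q k‖) := fun θ => by
      rw [logGap]; simp [hs, expSum, dotP, hq k hk]
    simp only [h, lintegral_const]
    exact ENNReal.mul_lt_top ENNReal.ofReal_lt_top (measure_lt_top _ _)
  | succ d ih =>
    obtain ⟨k₀, hk₀, hmin⟩ := Λ.exists_min_image (fun k => k 0) hΛ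
    obtain ⟨k₁, hk₁, hmax⟩ := Λ.exists_max_image (fun k => k 0) hΛ
    set m := k₀ 0
    set K := k₁ 0
    set Λ' : Finset (Fin d → ℤ) := (Λ.filter fun k => k 0 = m).image Fin.tail with hΛ'
    set q' : (Fin d → ℤ) → ℂ := fun k => q (Fin.cons m k) with hq'
    have hinj : Set.InjOn (Fin.tail : (Fin (d + 1) → ℤ) → Fin d → ℤ)
        (Λ.filter fun k => k 0 = m) := by
      intro a ha b hb hab
      simp only [Finset.coe_filter, mem_ofPred_eq] at ha hb
      rw [← Fin.cons_self_tail a, ← Fin.cons_self_tail b, ha.2, hb.2, hab]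
    have hcons : ∀ k ∈ Λ.filter (fun k => k 0 = m), q' (Fin.tail k) = q k := by
      intro k hk
      rw [hq', ← (Finset.mem_filter.1 hk).2]
      simp only [Fin.cons_self_tail]
    have hcoeff : ∀ y, (slicePoly d Λ q K y).coeff (K - m).toNat = expSum d Λ' q' y := by
      intro y
      rw [slicePoly, Polynomial.finsetSum_coeff, expSum, hΛ', Finset.sum_image hinj,
        Finset.sum_filter]
      refine Finset.sum_congr rfl fun k hk => ?_
      rw [Polynomial.coeff_monomial]
      have h1 := hmin k hk
      have h2 := hmax k hk
      have hiff : (K - k 0).toNat = (K - m).toNat ↔ k 0 = m := by omega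
      simp only [hiff]
      split_ifs with h
      · rw [hcons k (Finset.mem_filter.2 ⟨hk, h⟩)]
      · rfl
    have hdeg : ∀ y, (slicePoly d Λ q K y).natDegree ≤ (K - m).toNat := fun y =>
      Polynomial.natDegree_sum_le_of_forall_le _ _ fun k hk =>
        (Polynomial.natDegree_monomial_le _).trans (by have := hmin k hk; omega)
    have hnorm : ∀ x y, ‖(slicePoly d Λ q K y).eval (circleMap 0 1 x)‖ =
        ‖expSum (d + 1) Λ q (Fin.cons x y)‖ := fun x y => by
      rw [eval_slicePoly d Λ q K hmax, norm_mul, Complex.norm_exp_ofReal_mul_I, one_mul]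
    have hfin := ih Λ' ⟨Fin.tail k₀, Finset.mem_image_of_mem _ (by simp [hk₀, m])⟩ q' (by
      intro k hk
      obtain ⟨j, hj, rfl⟩ := Finset.mem_image.1 hk
      rw [hcons j hj]
      exact hq j (Finset.mem_filter.1 hj).1) (by
      refine le_trans ?_ hM
      rw [hΛ', Finset.sum_image hinj, Finset.sum_congr rfl fun k hk => by rw [hcons k hk]]
      exact Finset.sum_le_sum_of_subset_of_nonneg (Finset.filter_subset _ _) fun _ _ _ =>
        norm_nonneg _)
    have hmeas : Measurable fun θ => logGap M ‖expSum (d + 1) Λ q θ‖ :=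
      (measurable_logGap M).comp (continuous_expSum _ _ _).norm.measurable
    have hmp := (measurePreserving_piFinSuccAbove (fun _ : Fin (d + 1) =>
      (volume : Measure ℝ).restrict (Ioc (-Real.pi) Real.pi)) 0).symm
    rw [← hmp.lintegral_comp hmeas]
    refine lt_of_eq_of_lt (lintegral_prod_symm' _
      (hmeas.comp (MeasurableEquiv.measurable _))) ?_
    refine lt_of_le_of_lt (lintegral_mono (g := fun y =>
      ENNReal.ofReal (2 * Real.pi) * logGap M ‖expSum d Λ' q' y‖) fun y => ?_) ?_
    · have := lintegral_logGap_eval_le (slicePoly d Λ q K y) _ (hdeg y) M fun x => by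
        rw [hnorm]; exact (norm_expSum_le _ _ _ _).trans hM
      simp only [hnorm, hcoeff] at this
      exact (lintegral_congr fun x => congrArg (fun v => logGap M ‖expSum (d + 1) Λ q v‖)
        (Fin.insertNth_zero' x y)).trans_le this
    · rw [lintegral_const_mul' _ _ ENNReal.ofReal_ne_top]
      exact ENNReal.mul_lt_top ENNReal.ofReal_lt_top hfin

lemma dm_eq_smul_pi (d : ℕ) : dm d = (ENNReal.ofReal ((2 * Real.pi) ^ d))⁻¹ •
    Measure.pi fun _ : Fin d => (volume : Measure ℝ).restrict (Ioc (-Real.pi) Real.pi) := by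
  rw [dm, Td, volume_pi, Measure.restrict_pi_pi]

lemma inv_ofReal_two_pi_pow_ne_top (d : ℕ) : (ENNReal.ofReal ((2 * Real.pi) ^ d))⁻¹ ≠ ⊤ :=
  ENNReal.inv_ne_top.2 (ENNReal.ofReal_pos.2 (by positivity)).ne'

instance (d : ℕ) : IsFiniteMeasure (dm d) := by
  rw [dm_eq_smul_pi]
  exact Measure.smul_finite _ (inv_ofReal_two_pi_pow_ne_top d)

lemma ae_dm_mem_Td (d : ℕ) : ∀ᵐ θ ∂(dm d), θ ∈ Td d :=
  Measure.ae_smul_measure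
    (ae_restrict_mem (MeasurableSet.univ_pi fun _ => measurableSet_Ioc)) _

lemma continuous_eval (d : ℕ) (Λ : Finset (Fin d → ℤ)) (p : (Fin d → ℤ) → ℂ) :
    Continuous (eval d Λ p) :=
  Complex.continuous_re.comp (continuous_expSum d Λ p)

lemma abs_eval_le (d : ℕ) (Λ : Finset (Fin d → ℤ)) (p : (Fin d → ℤ) → ℂ) (θ : Fin d → ℝ) :
    |eval d Λ p θ| ≤ ∑ k ∈ Λ, ‖p k‖ :=
  (Complex.abs_re_le_norm _).trans (norm_expSum_le d Λ p θ)

lemma integrable_comp_eval (d : ℕ) (Λ : Finset (Fin d → ℤ)) (p : (Fin d → ℤ) → ℂ)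
    {f : ℝ → ℝ} (hf : Continuous f) : Integrable (fun θ => f (eval d Λ p θ)) (dm d) := by
  obtain ⟨C, hC⟩ := (isCompact_Icc (a := -∑ k ∈ Λ, ‖p k‖)
    (b := ∑ k ∈ Λ, ‖p k‖)).exists_bound_of_continuousOn hf.continuousOn
  exact Integrable.of_bound (hf.comp (continuous_eval d Λ p)).aestronglyMeasurable C
    (.of_forall fun θ => hC _ (abs_le.1 (abs_eval_le d Λ p θ)))

lemma expSum_eq_ofReal_eval (d : ℕ) (Λ : Finset (Fin d → ℤ)) (hΛ : ∀ k ∈ Λ, -k ∈ Λ)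
    (p : (Fin d → ℤ) → ℂ) (hp : IsCoeff d Λ p) (θ : Fin d → ℝ) :
    expSum d Λ p θ = eval d Λ p θ := by
  refine (Complex.conj_eq_iff_re.1 ?_).symm
  rw [expSum, map_sum]
  refine Finset.sum_nbij' (fun k => -k) (fun k => -k) hΛ hΛ (by simp) (by simp) fun k _ => ?_
  have : dotP d (-k) θ = -dotP d k θ := by simp [dotP]
  rw [map_mul, ← hp.2 k, ← Complex.exp_conj, this]
  simp

/-- A nonzero trigonometric polynomial has an integrable logarithm and vanishes only on a
null set. -/
lemma integrable_log_eval (d : ℕ) (Λ : Finset (Fin d → ℤ)) (hΛ : ∀ k ∈ Λ, -k ∈ Λ)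
    (q : (Fin d → ℤ) → ℂ) (hq : IsCoeff d Λ q) (hq0 : q ≠ 0) :
    Integrable (fun θ => Real.log (eval d Λ q θ)) (dm d) ∧ ∀ᵐ θ ∂(dm d), eval d Λ q θ ≠ 0 := by
  classical
  set Λ' := Λ.filter fun k => q k ≠ 0
  have hne : Λ'.Nonempty := by
    obtain ⟨k, hk⟩ := Function.ne_iff.1 hq0
    exact ⟨k, Finset.mem_filter.2 ⟨by_contra fun h => hk (hq.1 k h), hk⟩⟩
  have hsum : ∀ θ, ‖expSum d Λ' q θ‖ = |eval d Λ q θ| := fun θ => by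
    rw [← Real.norm_eq_abs, ← Complex.norm_real, ← expSum_eq_ofReal_eval d Λ hΛ q hq, expSum,
      Finset.sum_filter_of_ne fun k _ h => left_ne_zero_of_mul h, ← expSum]
  have hpos : 0 < ∑ k ∈ Λ', ‖q k‖ :=
    Finset.sum_pos (fun k hk => norm_pos_iff.2 (Finset.mem_filter.1 hk).2) hne
  set M := Real.log (∑ k ∈ Λ', ‖q k‖)
  have hfin : ∫⁻ θ, logGap M |eval d Λ q θ| ∂(dm d) < ⊤ := by
    have := lintegral_logGap_expSum_lt_top d Λ' hne q (fun k hk => (Finset.mem_filter.1 hk).2) M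
      (Real.exp_log hpos).ge
    simp only [hsum] at this
    rw [dm_eq_smul_pi, lintegral_smul_measure, smul_eq_mul]
    exact ENNReal.mul_lt_top (inv_ofReal_two_pi_pow_ne_top d).lt_top this
  have hmeas : Measurable fun θ => |eval d Λ q θ| := (continuous_eval d Λ q).abs.measurable
  have hae : ∀ᵐ θ ∂(dm d), eval d Λ q θ ≠ 0 := by
    filter_upwards [ae_lt_top ((measurable_logGap M).comp hmeas) hfin.ne] with θ hθ h
    simp [logGap, h] at hθ
  refine ⟨?_, hae⟩
  have hint : Integrable (fun θ => M - Real.log |eval d Λ q θ|) (dm d) := by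
    refine (lintegral_ofReal_ne_top_iff_integrable
      (measurable_const.sub hmeas.log).aestronglyMeasurable ?_).1 ?_
    · filter_upwards [hae] with θ hθ
      refine sub_nonneg.2 (Real.log_le_log (abs_pos.2 hθ) ?_)
      rw [← hsum]
      exact norm_expSum_le _ _ _ _
    · refine ne_of_eq_of_ne (lintegral_congr_ae ?_) hfin.ne
      filter_upwards [hae] with θ hθ
      rw [logGap, if_neg (abs_ne_zero.2 hθ)]
      rfl
  refine ((integrable_const M).sub hint).congr (.of_forall fun θ => ?_)
  simp

/-- The nonnegative integrand `P log (P/Q) + Q - P` of the divergence of `P` from `Q`. -/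
def divIntegrand (d : ℕ) (Λ : Finset (Fin d → ℤ)) (P Q : (Fin d → ℤ) → ℂ) (θ : Fin d → ℝ) : ℝ :=
  eval d Λ Q θ * InformationTheory.klFun (eval d Λ P θ / eval d Λ Q θ)

lemma measurable_divIntegrand (d : ℕ) (Λ : Finset (Fin d → ℤ)) (P Q : (Fin d → ℤ) → ℂ) :
    Measurable (divIntegrand d Λ P Q) :=
  (continuous_eval d Λ Q).measurable.mul (InformationTheory.measurable_klFun.comp
    ((continuous_eval d Λ P).measurable.div (continuous_eval d Λ Q).measurable))

lemma divIntegrand_nonneg {d : ℕ} {Λ : Finset (Fin d → ℤ)} {P Q : (Fin d → ℤ) → ℂ}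
    {θ : Fin d → ℝ} (hP : 0 ≤ eval d Λ P θ) (hQ : 0 ≤ eval d Λ Q θ) :
    0 ≤ divIntegrand d Λ P Q θ :=
  mul_nonneg hQ (InformationTheory.klFun_nonneg (div_nonneg hP hQ))

lemma divIntegrand_eq {d : ℕ} {Λ : Finset (Fin d → ℤ)} {P Q : (Fin d → ℤ) → ℂ}
    {θ : Fin d → ℝ} (hQ : eval d Λ Q θ ≠ 0) :
    divIntegrand d Λ P Q θ =
      eval d Λ P θ * Real.log (eval d Λ P θ) - eval d Λ P θ * Real.log (eval d Λ Q θ) +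
        (eval d Λ Q θ - eval d Λ P θ) := by
  rw [divIntegrand, InformationTheory.klFun_apply]
  by_cases hP : eval d Λ P θ = 0
  · simp [hP]
  · rw [Real.log_div hP hQ]
    field_simp
    ring

lemma integrable_divIntegrand (d : ℕ) (Λ : Finset (Fin d → ℤ)) (hΛ : ∀ k ∈ Λ, -k ∈ Λ)
    (P Q : (Fin d → ℤ) → ℂ) (hQ : IsCoeff d Λ Q) (hQ0 : Q ≠ 0) :
    Integrable (divIntegrand d Λ P Q) (dm d) := by
  obtain ⟨hlog, hae⟩ := integrable_log_eval d Λ hΛ Q hQ hQ0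
  have h1 := integrable_comp_eval d Λ P Real.continuous_mul_log
  have h2 : Integrable (fun θ => eval d Λ P θ * Real.log (eval d Λ Q θ)) (dm d) :=
    hlog.bdd_mul (continuous_eval d Λ P).aestronglyMeasurable
      (.of_forall (abs_eval_le d Λ P))
  have h3 := (integrable_comp_eval d Λ Q continuous_id).sub
    (integrable_comp_eval d Λ P continuous_id)
  refine ((h1.sub h2).add h3).congr ?_
  filter_upwards [hae] with θ hθ
  exact (divIntegrand_eq hθ).symm

lemma ae_divIntegrand_nonneg {d : ℕ} {Λ : Finset (Fin d → ℤ)} {P Q : (Fin d → ℤ) → ℂ}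
    (hP : P ∈ Pbar d Λ) (hQ : Q ∈ Pbar d Λ) : 0 ≤ᵐ[dm d] divIntegrand d Λ P Q := by
  filter_upwards [ae_dm_mem_Td d] with θ hθ
  exact divIntegrand_nonneg (hP.2 θ hθ) (hQ.2 θ hθ)

/-- `J` is a continuous function of the coefficients plus the divergence of `P` from `Q`. -/
lemma J2_eq (d : ℕ) (Λ : Finset (Fin d → ℤ)) (hΛ : ∀ k ∈ Λ, -k ∈ Λ)
    (c γ P Q : (Fin d → ℤ) → ℂ) (hP : P ∈ Pbar d Λ) (hQ : Q ∈ Pbar d Λ) (hQ0 : Q ≠ 0) :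
    J2 d Λ c γ P Q = pair d Λ c Q - pair d Λ γ P +
      ((∫ θ, eval d Λ P θ ∂(dm d)) - ∫ θ, eval d Λ Q θ ∂(dm d)) +
        (∫⁻ θ, ENNReal.ofReal (divIntegrand d Λ P Q θ) ∂(dm d)).toReal := by
  have hint := integrable_divIntegrand d Λ hΛ P Q hQ.1 hQ0
  have hPi := integrable_comp_eval d Λ P continuous_id
  have hQi := integrable_comp_eval d Λ Q continuous_id
  simp only [id_eq] at hPi hQi
  rw [← integral_eq_lintegral_of_nonneg_ae (ae_divIntegrand_nonneg hP hQ)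
    hint.aestronglyMeasurable, add_assoc, ← integral_sub hPi hQi,
    ← integral_add (f := fun θ => eval d Λ P θ - eval d Λ Q θ) (hPi.sub hQi) hint, J2]
  congr 1
  refine integral_congr_ae ?_
  filter_upwards [(integrable_log_eval d Λ hΛ Q hQ.1 hQ0).2] with θ hθ
  simp only [divIntegrand_eq hθ]
  split_ifs with h
  · simp [h]
  · rw [Real.log_div h hθ]
    ring

lemma continuous_pair (d : ℕ) (Λ : Finset (Fin d → ℤ)) (c : (Fin d → ℤ) → ℂ) :
    Continuous (pair d Λ c) := by
  unfold pair
  fun_prop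

lemma continuous_eval_left (d : ℕ) (Λ : Finset (Fin d → ℤ)) (θ : Fin d → ℝ) :
    Continuous fun p => eval d Λ p θ := by
  unfold eval
  fun_prop

lemma continuous_integral_eval (d : ℕ) (Λ : Finset (Fin d → ℤ)) :
    Continuous fun p => ∫ θ, eval d Λ p θ ∂(dm d) := by
  refine continuous_iff_continuousAt.2 fun p₀ => ?_
  have hb : ∀ᶠ p in nhds p₀, (∑ k ∈ Λ, ‖p k‖) < (∑ k ∈ Λ, ‖p₀ k‖) + 1 := by
    have : Continuous fun p : (Fin d → ℤ) → ℂ => ∑ k ∈ Λ, ‖p k‖ := by fun_prop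
    exact this.continuousAt.eventually_lt_const (lt_add_one _)
  refine continuousAt_of_dominated (bound := fun _ => (∑ k ∈ Λ, ‖p₀ k‖) + 1)
    (.of_forall fun p => (continuous_eval d Λ p).aestronglyMeasurable) ?_ (integrable_const _)
    (.of_forall fun θ => (continuous_eval_left d Λ θ).continuousAt)
  filter_upwards [hb] with p hp
  exact .of_forall fun θ => (abs_eval_le d Λ p θ).trans hp.le

/-- Fatou's lemma for the divergence, as a functional of the coefficients. -/
lemma lowerSemicontinuousWithinAt_toReal_lintegral_divIntegrand (d : ℕ)
    (Λ : Finset (Fin d → ℤ)) (hΛ : ∀ k ∈ Λ, -k ∈ Λ) (P₀ Q₀ : (Fin d → ℤ) → ℂ)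
    (hP₀ : P₀ ∈ Pbaro d Λ) (hQ₀ : Q₀ ∈ Pbar d Λ) (hQ₀ne : Q₀ ≠ 0) :
    LowerSemicontinuousWithinAt (fun x : ((Fin d → ℤ) → ℂ) × ((Fin d → ℤ) → ℂ) =>
      (∫⁻ θ, ENNReal.ofReal (divIntegrand d Λ x.1 x.2 θ) ∂(dm d)).toReal)
      (Pbaro d Λ ×ˢ (Pbar d Λ \ {0})) (P₀, Q₀) := by
  set s := Pbaro d Λ ×ˢ (Pbar d Λ \ {0})
  intro y hy
  rcases lt_or_ge y 0 with hy0 | hy0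
  · exact .of_forall fun x => hy0.trans_le ENNReal.toReal_nonneg
  have hfin : ∀ x ∈ s, ∫⁻ θ, ENNReal.ofReal (divIntegrand d Λ x.1 x.2 θ) ∂(dm d) ≠ ⊤ :=
    fun x hx => (integrable_divIntegrand d Λ hΛ x.1 x.2 hx.2.1.1 hx.2.2).lintegral_lt_top.ne
  have hae : ∀ᵐ θ ∂(dm d), Filter.liminf (fun x : ((Fin d → ℤ) → ℂ) × ((Fin d → ℤ) → ℂ) =>
      ENNReal.ofReal (divIntegrand d Λ x.1 x.2 θ)) (nhdsWithin (P₀, Q₀) s) =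
      ENNReal.ofReal (divIntegrand d Λ P₀ Q₀ θ) := by
    have : (nhdsWithin (P₀, Q₀) s).NeBot :=
      mem_closure_iff_nhdsWithin_neBot.1 (subset_closure ⟨hP₀, hQ₀, hQ₀ne⟩)
    filter_upwards [(integrable_log_eval d Λ hΛ Q₀ hQ₀.1 hQ₀ne).2] with θ hθ
    refine Filter.Tendsto.liminf_eq (ENNReal.tendsto_ofReal ?_)
    have hP : ContinuousAt (fun x : ((Fin d → ℤ) → ℂ) × ((Fin d → ℤ) → ℂ) => eval d Λ x.1 θ)
        (P₀, Q₀) := ((continuous_eval_left d Λ θ).comp continuous_fst).continuousAt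
    have hQ : ContinuousAt (fun x : ((Fin d → ℤ) → ℂ) × ((Fin d → ℤ) → ℂ) => eval d Λ x.2 θ)
        (P₀, Q₀) := ((continuous_eval_left d Λ θ).comp continuous_snd).continuousAt
    exact (hQ.mul (InformationTheory.continuous_klFun.continuousAt.comp
      (hP.div hQ hθ))).tendsto.mono_left nhdsWithin_le_nhds
  have hfatou : ∫⁻ θ, ENNReal.ofReal (divIntegrand d Λ P₀ Q₀ θ) ∂(dm d) ≤
      Filter.liminf (fun x : ((Fin d → ℤ) → ℂ) × ((Fin d → ℤ) → ℂ) =>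
        ∫⁻ θ, ENNReal.ofReal (divIntegrand d Λ x.1 x.2 θ) ∂(dm d)) (nhdsWithin (P₀, Q₀) s) := by
    rw [← lintegral_congr_ae hae]
    exact lintegral_liminf_le fun x => (measurable_divIntegrand d Λ x.1 x.2).ennreal_ofReal
  have hlt := ((ENNReal.ofReal_lt_iff_lt_toReal hy0
    (hfin (P₀, Q₀) ⟨hP₀, hQ₀, hQ₀ne⟩)).2 hy).trans_le hfatou
  filter_upwards [Filter.eventually_lt_of_lt_liminf hlt, self_mem_nhdsWithin] with x hx hxs
  exact (ENNReal.ofReal_lt_iff_lt_toReal hy0 (hfin x hxs)).1 hx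

/-- the functional (P,Q) ↦ J(P,Q) is lower semicontinuous on
𝔓̄₊,∘ × (𝔓̄₊ \ {0}). -/
theorem statement15 (d : ℕ) (hd : 1 ≤ d) (Λ : Finset (Fin d → ℤ))
    (h0 : (0 : Fin d → ℤ) ∈ Λ) (hΛ : ∀ k ∈ Λ, -k ∈ Λ)
    (c γ : (Fin d → ℤ) → ℂ) (hc : c ∈ Cplus d Λ)
    (hγ : IsCoeff d Λ γ) (hγ0 : γ 0 = 1) :
    LowerSemicontinuousOn (fun PQ : ((Fin d → ℤ) → ℂ) × ((Fin d → ℤ) → ℂ) =>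
        J2 d Λ c γ PQ.1 PQ.2)
      (Pbaro d Λ ×ˢ (Pbar d Λ \ {0})) := by
  rintro ⟨P₀, Q₀⟩ ⟨hP₀, hQ₀, hQ₀ne⟩
  set s := Pbaro d Λ ×ˢ (Pbar d Λ \ {0})
  have hlin : LowerSemicontinuousWithinAt (fun x : ((Fin d → ℤ) → ℂ) × ((Fin d → ℤ) → ℂ) =>
      pair d Λ c x.2 - pair d Λ γ x.1 +
        ((∫ θ, eval d Λ x.1 θ ∂(dm d)) - ∫ θ, eval d Λ x.2 θ ∂(dm d))) s (P₀, Q₀) := by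
    have h := continuous_integral_eval d Λ
    exact ((((continuous_pair d Λ c).comp continuous_snd).sub
      ((continuous_pair d Λ γ).comp continuous_fst)).add
      ((h.comp continuous_fst).sub
        (h.comp continuous_snd))).lowerSemicontinuous.lowerSemicontinuousWithinAt _ _
  refine ((hlin.add (lowerSemicontinuousWithinAt_toReal_lintegral_divIntegrand d Λ hΛ P₀ Q₀
    hP₀ hQ₀ hQ₀ne)).congr_of_eventuallyEq (a := (P₀, Q₀)) ⟨hP₀, hQ₀, hQ₀ne⟩ ?_)
  filter_upwards [self_mem_nhdsWithin] with x hx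
  exact (J2_eq d Λ hΛ c γ x.1 x.2 hx.1.1 hx.2.1 hx.2.2).symm

end RCE
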